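/- Let k ≥ 1 and let e be a sequence of actions such that msc(e) satisfies peer-to-peer causal delivery. Then msc(e) is k-synchronous (peer-to-peer) if and only if every strongly connected component of its conflict graph has size at most k and no RS edge (an edge of the form v →_{RS} v') occurs on any cyclic path of the conflict graph. -/

import Mathlib

set_option autoImplicit false

/-! ## Actions -/

/-- A send or receive action over processes `P` and messages `M`. -/
inductive Act (P M : Type) : Type
  | send (p q : P) (m : M)
  | recv (p q : P) (m : M)
  deriving DecidableEq

namespace Act
variable {P M : Type}

def isSend : Act P M → Prop
  | send _ _ _ => True
  | recv _ _ _ => False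

def isRecv : Act P M → Prop
  | send _ _ _ => False
  | recv _ _ _ => True

/-- The process performing the action: the sender of a send, the receiver of a receive. -/
def proc : Act P M → P
  | send p _ _ => p
  | recv _ q _ => q

end Act

/-- The two kinds of actions of a message exchange: `S`end and `R`eceive. -/
inductive SR : Type
  | S | R
  deriving DecidableEq

/-- Nodes of conflict graphs with summary nodes: ordinary message exchanges
(identified by the position of their send action), summary nodes `λ_p`, and the node `ψ`. -/
inductive GNode (P : Type) : Type
  | ex (v : ℕ)
  | sum (p : P)
  | psi

/-! ## Matching, message exchanges -/

section Core
variable {P M : Type} [DecidableEq P] [DecidableEq M]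

/-- The send at position `i` of `e` is matched by the receive at position `j`:
for some `ℓ`, they are the `ℓ`-th send resp. receive with the given sender/receiver/message. -/
def Matches (e : List (Act P M)) (i j : ℕ) : Prop :=
  i < j ∧ j < e.length ∧ ∃ p q m,
    e[i]? = some (Act.send p q m) ∧ e[j]? = some (Act.recv p q m) ∧
    (e.take (i + 1)).count (Act.send p q m) = (e.take (j + 1)).count (Act.recv p q m)

/-- Message exchanges (vertices of the conflict graph) are identified with the
positions of their send actions. -/
def IsVertex (e : List (Act P M)) (v : ℕ) : Prop :=
  ∃ p q m, e[v]? = some (Act.send p q m)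

def MatchedSend (e : List (Act P M)) (v : ℕ) : Prop := ∃ j, Matches e v j

def UnmatchedSend (e : List (Act P M)) (v : ℕ) : Prop := IsVertex e v ∧ ¬ MatchedSend e v

def SenderIs (e : List (Act P M)) (v : ℕ) (p : P) : Prop := ∃ q m, e[v]? = some (Act.send p q m)

def ReceiverIs (e : List (Act P M)) (v : ℕ) (q : P) : Prop := ∃ p m, e[v]? = some (Act.send p q m)

/-- A well-formed sequence of actions: every receive is matched. -/
def WFSeq (e : List (Act P M)) : Prop :=
  ∀ j p q m, e[j]? = some (Act.recv p q m) → ∃ i, Matches e i j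

end Core

/-! ## MSCs -/

/-- A message sequence chart, presented on `Fin n`. MSCs are identified up to isomorphism. -/
structure MSC (P M : Type) : Type where
  n : ℕ
  label : Fin n → Act P M
  po : Fin n → Fin n → Prop
  src : Fin n → Fin n → Prop

namespace MSC
variable {P M : Type}

/-- The causality order `≺ = (≺_po ∪ ≺_src)⁺`. -/
def prec (m : MSC P M) : Fin m.n → Fin m.n → Prop :=
  Relation.TransGen (fun i j => m.po i j ∨ m.src i j)

/-- Well-formedness of an MSC: `po` is a strict partial order total on each process's
events, and `src` relates each receive to exactly one send with matching labels,
each send to at most one receive. -/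
def WF (m : MSC P M) : Prop :=
  Transitive m.po ∧ (∀ i, ¬ m.po i i) ∧
  (∀ i j, i ≠ j → (m.label i).proc = (m.label j).proc → m.po i j ∨ m.po j i) ∧
  (∀ r, (m.label r).isRecv → ∃! s, m.src s r) ∧
  (∀ s, (m.label s).isSend → ∀ r r', m.src s r → m.src s r' → r = r') ∧
  (∀ s r, m.src s r → ∃ p q v, m.label s = Act.send p q v ∧ m.label r = Act.recv p q v)

end MSC

section MSCs
variable {P M : Type} [DecidableEq P] [DecidableEq M]

/-- The MSC `msc(e)` of a (well-formed) sequence of actions `e`. -/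
def mscOf (e : List (Act P M)) : MSC P M where
  n := e.length
  label i := e.get i
  po i j := (i : ℕ) < (j : ℕ) ∧ (e.get i).proc = (e.get j).proc
  src i j := Matches e i j

/-- `f` is an isomorphism of MSCs. -/
def IsMSCIso (m₁ m₂ : MSC P M) (f : Fin m₁.n ≃ Fin m₂.n) : Prop :=
  (∀ i, m₂.label (f i) = m₁.label i) ∧
  (∀ i j, m₁.po i j ↔ m₂.po (f i) (f j)) ∧
  (∀ i j, m₁.src i j ↔ m₂.src (f i) (f j))

/-- Isomorphism of MSCs (MSCs are identified up to isomorphism). -/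
def MSC.Iso (m₁ m₂ : MSC P M) : Prop := ∃ f, IsMSCIso m₁ m₂ f

/-- `e` is a linearisation of the MSC `m`: `e` is well-formed and `msc(e) = m`. -/
def Linearisation (e : List (Act P M)) (m : MSC P M) : Prop :=
  WFSeq e ∧ MSC.Iso (mscOf e) m

/-- Causal delivery (mailbox): some linearisation is such that any two causally ordered
sends to a same process are either received in the same order, or the later one is unmatched. -/
def CausalDelivery (m : MSC P M) : Prop :=
  ∃ e : List (Act P M), Linearisation e m ∧
    ∀ (i j : Fin (mscOf e).n) (p p' q : P) (v v' : M),
      (mscOf e).prec i j →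
      (mscOf e).label i = Act.send p q v →
      (mscOf e).label j = Act.send p' q v' →
      (¬ MatchedSend e j.val) ∨
        ∃ i' j' : Fin (mscOf e).n,
          Matches e i.val i'.val ∧ Matches e j.val j'.val ∧ (mscOf e).prec i' j'

/-- Peer-to-peer causal delivery: as causal delivery but only for two sends with the
same sender *and* the same receiver. -/
def P2PCausalDelivery (m : MSC P M) : Prop :=
  ∃ e : List (Act P M), Linearisation e m ∧
    ∀ (i j : Fin (mscOf e).n) (p q : P) (v v' : M),
      (mscOf e).prec i j →
      (mscOf e).label i = Act.send p q v →
      (mscOf e).label j = Act.send p q v' →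
      (¬ MatchedSend e j.val) ∨
        ∃ i' j' : Fin (mscOf e).n,
          Matches e i.val i'.val ∧ Matches e j.val j'.val ∧ (mscOf e).prec i' j'

end MSCs

/-! ## Conflict graphs -/

section CG
variable {P M : Type} [DecidableEq P] [DecidableEq M]

/-- The position of the `X`-action of the message exchange `v`. -/
def XAt (e : List (Act P M)) (v : ℕ) : SR → ℕ → Prop
  | SR.S, i => i = v ∧ IsVertex e v
  | SR.R, i => Matches e v i

/-- The edge `v →_{XY} v'` of the conflict graph of `e`. -/
def CGEdge (e : List (Act P M)) (X Y : SR) (v v' : ℕ) : Prop :=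
  ∃ i j, XAt e v X i ∧ XAt e v' Y j ∧ i < j ∧
    ∃ a a' : Act P M, e[i]? = some a ∧ e[j]? = some a' ∧ a.proc = a'.proc

def CGStep (e : List (Act P M)) (v v' : ℕ) : Prop := ∃ X Y, CGEdge e X Y v v'

/-- Reachability `v →* v'` in the conflict graph. -/
def Reach (e : List (Act P M)) : ℕ → ℕ → Prop := Relation.ReflTransGen (CGStep e)

/-- `U` is a strongly connected component of the conflict graph of `e`. -/
def IsSCC (e : List (Act P M)) (U : Finset ℕ) : Prop :=
  (∀ v ∈ U, IsVertex e v) ∧ ∀ v ∈ U, ∀ v' ∈ U, Reach e v v' ∧ Reach e v' v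

/-- Extended edges `v ⊑_{XY} v'` of the extended conflict graph. -/
inductive ExtEdge (e : List (Act P M)) : SR → SR → ℕ → ℕ → Prop
  | base {X Y : SR} {v v' : ℕ} : CGEdge e X Y v v' → ExtEdge e X Y v v'
  | matched {v : ℕ} : MatchedSend e v → ExtEdge e SR.S SR.R v v
  | rr {v v' : ℕ} : CGEdge e SR.R SR.R v v' → ExtEdge e SR.S SR.S v v'
  | mbox {v v' : ℕ} {q : P} : MatchedSend e v → UnmatchedSend e v' →
      ReceiverIs e v q → ReceiverIs e v' q → ExtEdge e SR.S SR.S v v'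
  | trans {X Y Z : SR} {v v' v'' : ℕ} : ExtEdge e X Y v v'' → ExtEdge e Y Z v'' v' →
      ExtEdge e X Z v v'

/-- The process performing the `X`-action of the exchange `v`. -/
def XProcIs (e : List (Act P M)) (v : ℕ) : SR → P → Prop
  | SR.S, r => SenderIs e v r
  | SR.R, r => ∃ j, Matches e v j ∧ ∃ p m, e[j]? = some (Act.recv p r m)

/-- The set of processes involved in the exchange `v`. -/
def vprocs (e : List (Act P M)) (v : ℕ) : Set P :=
  {r | SenderIs e v r ∨ (MatchedSend e v ∧ ReceiverIs e v r)}

end CG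

/-! ## k-exchanges and k-synchronous MSCs -/

section KSync
variable {P M : Type} [DecidableEq P] [DecidableEq M]

/-- A block in `S^{≤k}·R^{≤k}`: at most `k` sends followed by at most `k` receives. -/
def IsBlock (k : ℕ) (b : List (Act P M)) : Prop :=
  ∃ ss rs : List (Act P M), b = ss ++ rs ∧ (∀ a ∈ ss, a.isSend) ∧ (∀ a ∈ rs, a.isRecv) ∧
    ss.length ≤ k ∧ rs.length ≤ k

def blockStart (es : List (List (Act P M))) (b : ℕ) : ℕ :=
  ((es.take b).map List.length).sum

/-- Positions `i` and `j` of `es.flatten` lie in the same block of `es`. -/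
def SameBlock (es : List (List (Act P M))) (i j : ℕ) : Prop :=
  ∃ b, b < es.length ∧ blockStart es b ≤ i ∧ i < blockStart es (b + 1) ∧
    blockStart es b ≤ j ∧ j < blockStart es (b + 1)

/-- An MSC is `k`-synchronous: it satisfies causal delivery and it has a linearisation
divisible into blocks of `S^{≤k}·R^{≤k}` in which every matched pair lies in one block. -/
def KSyncMSC (k : ℕ) (m : MSC P M) : Prop :=
  CausalDelivery m ∧
  ∃ es : List (List (Act P M)), Linearisation es.flatten m ∧
    (∀ b ∈ es, IsBlock k b) ∧
    ∀ i j, Matches es.flatten i j → SameBlock es i j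

/-- A sequence of actions is `k`-synchronizable if its MSC is `k`-synchronous. -/
def KSyncSeq (k : ℕ) (e : List (Act P M)) : Prop := KSyncMSC k (mscOf e)

/-- The peer-to-peer variant of `k`-synchrony. -/
def P2PKSyncMSC (k : ℕ) (m : MSC P M) : Prop :=
  P2PCausalDelivery m ∧
  ∃ es : List (List (Act P M)), Linearisation es.flatten m ∧
    (∀ b ∈ es, IsBlock k b) ∧
    ∀ i j, Matches es.flatten i j → SameBlock es i j

def P2PKSyncSeq (k : ℕ) (e : List (Act P M)) : Prop := P2PKSyncMSC k (mscOf e)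

end KSync

/-! ## Communicating systems (mailbox semantics) -/

/-- A system of communicating finite state machines: a transition relation and an
initial state for each process. -/
structure CSystem (P M St : Type) : Type where
  delta : P → St → Act P M → St → Prop
  init : P → St

section Mailbox
variable {P M St : Type} [DecidableEq P] [DecidableEq M]

/-- One step of the mailbox semantics on configurations (global state, one buffer per process). -/
inductive MStep (S : CSystem P M St) :
    ((P → St) × (P → List M)) → Act P M → ((P → St) × (P → List M)) → Prop
  | send {l : P → St} {b : P → List M} {p q : P} {m : M} {l' : St} :
      S.delta p (l p) (Act.send p q m) l' →
      MStep S (l, b) (Act.send p q m)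
        (Function.update l p l', Function.update b q (b q ++ [m]))
  | recv {l : P → St} {b : P → List M} {p q : P} {m : M} {l' : St} {rest : List M} :
      S.delta q (l q) (Act.recv p q m) l' → b q = m :: rest →
      MStep S (l, b) (Act.recv p q m)
        (Function.update l q l', Function.update b q rest)

/-- Execution of a sequence of actions between two configurations. -/
inductive ExecFrom (S : CSystem P M St) :
    ((P → St) × (P → List M)) → List (Act P M) → ((P → St) × (P → List M)) → Prop
  | nil {c} : ExecFrom S c [] c
  | cons {c a c' e c''} : MStep S c a c' → ExecFrom S c' e c'' → ExecFrom S c (a :: e) c''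

def initConf (S : CSystem P M St) : (P → St) × (P → List M) := (S.init, fun _ => [])

/-- `asEx(S)`: `e` is an (asynchronous) execution of `S`. -/
def asEx (S : CSystem P M St) (e : List (Act P M)) : Prop :=
  ∃ c, ExecFrom S (initConf S) e c

/-- `S` is `k`-synchronizable: every execution of `S` is `k`-synchronizable. -/
def KSynchronizable (k : ℕ) (S : CSystem P M St) : Prop :=
  ∀ e, asEx S e → KSyncSeq k e

end Mailbox

/-! ## The instrumented system -/

abbrev IProc (P : Type) : Type := Option P
abbrev IMsg (P M : Type) : Type := Sum M (P × M)
abbrev ISt (P M St : Type) : Type := Sum St (Sum (P × M) Bool)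
abbrev IAct (P M : Type) : Type := Act (IProc P) (IMsg P M)

def liftAct {P M : Type} : Act P M → IAct P M
  | Act.send p q m => Act.send (some p) (some q) (Sum.inl m)
  | Act.recv p q m => Act.recv (some p) (some q) (Sum.inl m)

/-- Transitions of the instrumented system `S'`: the original transitions, deviations
of sends/receives through the fresh process `π` (= `none`), and the behaviour of `π`. -/
inductive IDelta {P M St : Type} (S : CSystem P M St) :
    IProc P → ISt P M St → IAct P M → ISt P M St → Prop
  | origSend {p q : P} {m : M} {s s' : St} :
      S.delta p s (Act.send p q m) s' →
      IDelta S (some p) (Sum.inl s) (Act.send (some p) (some q) (Sum.inl m)) (Sum.inl s')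
  | origRecv {p q : P} {m : M} {s s' : St} :
      S.delta q s (Act.recv p q m) s' →
      IDelta S (some q) (Sum.inl s) (Act.recv (some p) (some q) (Sum.inl m)) (Sum.inl s')
  | devSend {p q : P} {m : M} {s s' : St} :
      S.delta p s (Act.send p q m) s' →
      IDelta S (some p) (Sum.inl s) (Act.send (some p) none (Sum.inr (q, m))) (Sum.inl s')
  | devRecv {p q : P} {m : M} {s s' : St} :
      S.delta q s (Act.recv p q m) s' →
      IDelta S (some q) (Sum.inl s) (Act.recv none (some q) (Sum.inl m)) (Sum.inl s')
  | piRecv {p q : P} {m : M} :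
      IDelta S none (Sum.inr (Sum.inr false)) (Act.recv (some p) none (Sum.inr (q, m)))
        (Sum.inr (Sum.inl (q, m)))
  | piSend {q : P} {m : M} :
      IDelta S none (Sum.inr (Sum.inl (q, m))) (Act.send none (some q) (Sum.inl m))
        (Sum.inr (Sum.inr true))

/-- The instrumented system `S'`. -/
def instrumented {P M St : Type} (S : CSystem P M St) :
    CSystem (IProc P) (IMsg P M) (ISt P M St) where
  delta := IDelta S
  init := fun p => match p with
    | some p => Sum.inl (S.init p)
    | none => Sum.inr (Sum.inr false)

section Deviate
variable {P M St : Type} [DecidableEq P] [DecidableEq M]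

/-- `e'` is obtained from `ec = e₁·send(p,q,m)·e₂·rec(p,q,m)` (the final receive being
matched by the exhibited send) by deviating that message exchange through `π`. -/
def Deviate (e' : List (IAct P M)) (ec : List (Act P M)) : Prop :=
  ∃ (e₁ e₂ : List (Act P M)) (p q : P) (m : M),
    ec = e₁ ++ [Act.send p q m] ++ e₂ ++ [Act.recv p q m] ∧
    Matches ec e₁.length (ec.length - 1) ∧
    e' = e₁.map liftAct ++
      [Act.send (some p) none (Sum.inr (q, m)), Act.recv (some p) none (Sum.inr (q, m))] ++
      e₂.map liftAct ++
      [Act.send none (some q) (Sum.inl m), Act.recv none (some q) (Sum.inl m)]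

/-- A (k-synchronizable) execution `e'` of `S'` is feasible if it is the deviation of an
execution of `S`. -/
def Feasible (S : CSystem P M St) (e' : List (IAct P M)) : Prop :=
  ∃ ec, asEx S ec ∧ Deviate e' ec

/-- A feasible execution `e' = deviate(e·r)` is bad if `e·r` is not `k`-synchronizable. -/
def BadExec (k : ℕ) (S : CSystem P M St) (e' : List (IAct P M)) : Prop :=
  ∃ ec, asEx S ec ∧ Deviate e' ec ∧ ¬ KSyncSeq k ec

end Deviate

/-! ## Conflict graphs with summary nodes and the k-exchange transition relation -/

section Summary
variable {P M : Type} [DecidableEq P] [DecidableEq M]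

/-- Select by `X ∈ {S,R}` the corresponding component of a pair of sets of processes. -/
def selC {P : Type} : SR → Set P × Set P → Set P
  | SR.S, c => c.1
  | SR.R, c => c.2

/-- Edges of the conflict graph `CG(e,B,Cπ)` with summary nodes `λ_p` and `ψ`.
(For the graph `CG(e,B)` without `ψ` take `Cπ = (∅,∅)`, which makes `ψ` isolated.) -/
inductive SCGEdge (e : List (Act P M)) (B : P → Set P × Set P) (Cpi : Set P × Set P) :
    SR → SR → GNode P → GNode P → Prop
  | base {X Y : SR} {v v' : ℕ} :
      CGEdge e X Y v v' → SCGEdge e B Cpi X Y (GNode.ex v) (GNode.ex v')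
  | sum1 {p : P} {X : SR} {v : ℕ} {r : P} :
      XProcIs e v X r → r ∈ (B p).1 → SCGEdge e B Cpi SR.S X (GNode.sum p) (GNode.ex v)
  | sum2 {p : P} {X : SR} {v : ℕ} {r : P} :
      XProcIs e v X r → r ∈ (B p).2 → MatchedSend e v →
      SCGEdge e B Cpi SR.S SR.S (GNode.sum p) (GNode.ex v)
  | sum3 {p : P} {v : ℕ} {q : P} :
      ReceiverIs e v q → q ∈ (B p).2 → UnmatchedSend e v →
      SCGEdge e B Cpi SR.S SR.S (GNode.sum p) (GNode.ex v)
  | sum4 {p : P} {v : ℕ} :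
      ReceiverIs e v p → MatchedSend e v →
      SCGEdge e B Cpi SR.S SR.S (GNode.ex v) (GNode.sum p)
  | sum5 {q p : P} :
      p ∈ (B q).2 → SCGEdge e B Cpi SR.S SR.S (GNode.sum q) (GNode.sum p)
  | psi1 {X : SR} {v : ℕ} {r : P} :
      XProcIs e v X r → r ∈ Cpi.1 → SCGEdge e B Cpi SR.S X GNode.psi (GNode.ex v)
  | psi2 {X : SR} {v : ℕ} {r : P} :
      XProcIs e v X r → r ∈ Cpi.2 → MatchedSend e v →
      SCGEdge e B Cpi SR.S SR.S GNode.psi (GNode.ex v)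
  | psi3 {v : ℕ} {q : P} :
      ReceiverIs e v q → q ∈ Cpi.2 → UnmatchedSend e v →
      SCGEdge e B Cpi SR.S SR.S GNode.psi (GNode.ex v)
  | psi4 {p : P} :
      p ∈ Cpi.2 → SCGEdge e B Cpi SR.S SR.S GNode.psi (GNode.sum p)

/-- Extended edges of the conflict graph with summary nodes. -/
inductive SExtEdge (e : List (Act P M)) (B : P → Set P × Set P) (Cpi : Set P × Set P) :
    SR → SR → GNode P → GNode P → Prop
  | base {X Y : SR} {n n' : GNode P} :
      SCGEdge e B Cpi X Y n n' → SExtEdge e B Cpi X Y n n'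
  | matched {v : ℕ} :
      MatchedSend e v → SExtEdge e B Cpi SR.S SR.R (GNode.ex v) (GNode.ex v)
  | rr {n n' : GNode P} :
      SCGEdge e B Cpi SR.R SR.R n n' → SExtEdge e B Cpi SR.S SR.S n n'
  | mbox {v v' : ℕ} {q : P} :
      MatchedSend e v → UnmatchedSend e v' → ReceiverIs e v q → ReceiverIs e v' q →
      SExtEdge e B Cpi SR.S SR.S (GNode.ex v) (GNode.ex v')
  | trans {X Y Z : SR} {n n' n'' : GNode P} :
      SExtEdge e B Cpi X Y n n'' → SExtEdge e B Cpi Y Z n'' n' → SExtEdge e B Cpi X Z n n'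

/-- The nodes `Unm_p`: the summary node `λ_p` together with the unmatched exchanges of `e`
with receiver `p`. -/
def UnmNode (e : List (Act P M)) (p : P) : GNode P → Prop
  | GNode.ex v => UnmatchedSend e v ∧ ReceiverIs e v p
  | GNode.sum q => q = p
  | GNode.psi => False

/-- The updated component `C'_{X,p}` of `B` after the k-exchange `e`. -/
def nextC (e : List (Act P M)) (B : P → Set P × Set P) (X : SR) (p : P) : Set P :=
  selC X (B p)
  ∪ {s | X = SR.S ∧ ∃ v, UnmatchedSend e v ∧ ReceiverIs e v p ∧ SenderIs e v s}
  ∪ {r | ∃ n v', UnmNode e p n ∧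
      SExtEdge e B ((∅, ∅) : Set P × Set P) SR.S SR.S n (GNode.ex v') ∧ XProcIs e v' X r}
  ∪ {r | ∃ q n, ((∃ v, n = GNode.ex v ∧ ReceiverIs e v p) ∨ n = GNode.sum p) ∧
      SExtEdge e B ((∅, ∅) : Set P × Set P) SR.S SR.S n (GNode.sum q) ∧ r ∈ selC X (B q)}

/-- The updated component `C^π_X'` after the k-exchange `e`, where `piP` is the process `π`. -/
def nextCpi (piP : P) (e : List (Act P M)) (B : P → Set P × Set P) (Cpi : Set P × Set P)
    (X : SR) : Set P :=
  selC X Cpi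
  ∪ {s | X = SR.S ∧ ∃ v, ReceiverIs e v piP ∧ SenderIs e v s}
  ∪ {r | ∃ n v', ((∃ v, n = GNode.ex v ∧ ReceiverIs e v piP) ∨ n = GNode.psi) ∧
      SExtEdge e B Cpi SR.S SR.S n (GNode.ex v') ∧ XProcIs e v' X r}
  ∪ {r | ∃ q n, ((∃ v, n = GNode.ex v ∧ ReceiverIs e v piP) ∨ n = GNode.psi) ∧
      SExtEdge e B Cpi SR.S SR.S n (GNode.sum q) ∧ r ∈ selC X (B q)}

end Summary

section KExchange
variable {P M St : Type} [DecidableEq P] [DecidableEq M]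

/-- The transition relation `(l⃗,B) ⇝^e_k (l⃗',B')` on abstract configurations. -/
def KExch (S : CSystem P M St) (k : ℕ) (e : List (Act P M))
    (c c' : (P → St) × (P → Set P × Set P)) : Prop :=
  (∃ ss rs : List (Act P M), e = ss ++ rs ∧ (∀ a ∈ ss, a.isSend) ∧ (∀ a ∈ rs, a.isRecv) ∧
    rs.length ≤ ss.length ∧ ss.length ≤ k) ∧
  (∃ buf, ExecFrom S (c.1, fun _ => []) e (c'.1, buf)) ∧
  (∀ p X, selC X (c'.2 p) = nextC e c.2 X p) ∧
  ∀ p, p ∉ selC SR.R (c'.2 p)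

/-- Iterated `⇝^{e_1}_k ⋯ ⇝^{e_n}_k`. -/
inductive KChain (S : CSystem P M St) (k : ℕ) :
    ((P → St) × (P → Set P × Set P)) → List (List (Act P M)) →
    ((P → St) × (P → Set P × Set P)) → Prop
  | nil {c} : KChain S k c [] c
  | cons {c e c' es c''} :
      KExch S k e c c' → KChain S k c' es c'' → KChain S k c (e :: es) c''

end KExchange

/-! ## The transition relation recognising feasible executions -/

/-- Abstract configurations `(l⃗, B, C⃗^π, dest)` for the instrumented system. -/
structure PiAConf (P M St : Type) : Type where
  gs : IProc P → ISt P M St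
  B : IProc P → Set (IProc P) × Set (IProc P)
  Cpi : Set (IProc P) × Set (IProc P)
  dest : Option P

section PiTrans
variable {P M St : Type} [DecidableEq P] [DecidableEq M]

/-- The transition relation `(l⃗,B,C^π_S,C^π_R,dest) ⇝^e_k (l⃗',B',C^π_S',C^π_R',dest')`. -/
def PiTrans (S : CSystem P M St) (k : ℕ) (e : List (IAct P M))
    (c c' : PiAConf P M St) : Prop :=
  KExch (instrumented S) k e (c.gs, c.B) (c'.gs, c'.B) ∧
  (∀ v, ¬ SenderIs e v (none : IProc P)) ∧
  (∀ v v', ReceiverIs e v (none : IProc P) → ReceiverIs e v' (none : IProc P) →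
    v = v' ∧ c.dest = none) ∧
  ((∃ (d : ℕ) (p q : P) (m : M),
      e[d]? = some (Act.send (some p) none (Sum.inr (q, m))) ∧ c'.dest = some q) ∨
   ((¬ ∃ (d : ℕ) (p q : P) (m : M),
      e[d]? = some (Act.send (some p) none (Sum.inr (q, m)))) ∧ c'.dest = c.dest)) ∧
  (c.dest ≠ none → c'.dest = c.dest) ∧
  (∀ X, selC X c'.Cpi = nextCpi (none : IProc P) e c.B c.Cpi X) ∧
  ∀ q : P, c'.dest = some q → (some q : IProc P) ∉ c'.Cpi.2

inductive PiChain (S : CSystem P M St) (k : ℕ) :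
    PiAConf P M St → List (List (IAct P M)) → PiAConf P M St → Prop
  | nil {c} : PiChain S k c [] c
  | cons {c e c' es c''} :
      PiTrans S k e c c' → PiChain S k c' es c'' → PiChain S k c (e :: es) c''

/-- The initial abstract configuration `(l⃗_0, B_0, (∅,∅), ⊥)`. -/
def initPi (S : CSystem P M St) : PiAConf P M St :=
  ⟨(instrumented S).init, fun _ => (∅, ∅), (∅, ∅), none⟩

end PiTrans

/-! ## The transition relation recognising bad executions -/

/-- Abstract configurations `(P, Q, cnt, sawRS, lastIsRec)`. -/
structure BVConf (P : Type) : Type where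
  Ps : Set P
  Qs : Set P
  cnt : ℕ
  sawRS : Bool
  lir : P → Bool

section BV
variable {P M : Type} [DecidableEq P] [DecidableEq M]

/-- `succ_e(Ps)`: vertices reachable from a vertex involving a process of `Ps`. -/
def succSet (e : List (Act P M)) (Ps : Set P) : Set ℕ :=
  {v | IsVertex e v ∧ ∃ u, IsVertex e u ∧ (∃ r ∈ vprocs e u, r ∈ Ps) ∧ Reach e u v}

/-- `pred_e(Qs)`: vertices co-reachable from a vertex involving a process of `Qs`. -/
def predSet (e : List (Act P M)) (Qs : Set P) : Set ℕ :=
  {v | IsVertex e v ∧ ∃ u, IsVertex e u ∧ (∃ r ∈ vprocs e u, r ∈ Qs) ∧ Reach e v u}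

/-- The transition relation of Fig. 9, `piP` being the process `π`. -/
def BTrans (piP : P) (k : ℕ) (e : List (Act P M)) (c c' : BVConf P) : Prop :=
  c'.Ps = {r | ∃ v ∈ succSet e c.Ps, r ∈ vprocs e v} ∧
  c.Qs = {r | ∃ v ∈ predSet e c'.Qs, r ∈ vprocs e v} ∧
  c'.cnt = min (k + 2) (c.cnt + (succSet e c.Ps ∩ predSet e c'.Qs).ncard) ∧
  (∀ q : P, c'.lir q = true ↔
    ((∃ v ∈ succSet e c.Ps ∩ predSet e c'.Qs, MatchedSend e v ∧ ReceiverIs e v q) ∨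
     (c.lir q = true ∧ ¬ ∃ v, IsVertex e v ∧ SenderIs e v q))) ∧
  (c'.sawRS = true ↔
    (c.sawRS = true ∨ ∃ v ∈ succSet e c.Ps ∩ predSet e c'.Qs, ∃ p : P, p ≠ piP ∧
      SenderIs e v p ∧ c.lir p = true ∧ p ∈ c.Ps ∧ p ∈ c.Qs))

inductive BChain (piP : P) (k : ℕ) :
    BVConf P → List (List (Act P M)) → BVConf P → Prop
  | nil {c} : BChain piP k c [] c
  | cons {c e c' es c''} :
      BTrans piP k e c c' → BChain piP k c' es c'' → BChain piP k c (e :: es) c''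

end BV

/-! ## Peer-to-peer systems -/

section P2P
variable {P M St : Type} [DecidableEq P] [DecidableEq M]

/-- One step of the peer-to-peer semantics (one buffer per ordered pair of processes). -/
inductive P2PStep (S : CSystem P M St) :
    ((P → St) × (P → P → List M)) → Act P M → ((P → St) × (P → P → List M)) → Prop
  | send {l : P → St} {b : P → P → List M} {p q : P} {m : M} {l' : St} :
      S.delta p (l p) (Act.send p q m) l' →
      P2PStep S (l, b) (Act.send p q m)
        (Function.update l p l',
          fun p' q' => if p' = p ∧ q' = q then b p q ++ [m] else b p' q')
  | recv {l : P → St} {b : P → P → List M} {p q : P} {m : M} {l' : St} {rest : List M} :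
      S.delta q (l q) (Act.recv p q m) l' → b p q = m :: rest →
      P2PStep S (l, b) (Act.recv p q m)
        (Function.update l q l',
          fun p' q' => if p' = p ∧ q' = q then rest else b p' q')

inductive P2PExecFrom (S : CSystem P M St) :
    ((P → St) × (P → P → List M)) → List (Act P M) → ((P → St) × (P → P → List M)) → Prop
  | nil {c} : P2PExecFrom S c [] c
  | cons {c a c' e c''} :
      P2PStep S c a c' → P2PExecFrom S c' e c'' → P2PExecFrom S c (a :: e) c''

def p2pInitConf (S : CSystem P M St) : (P → St) × (P → P → List M) :=
  (S.init, fun _ _ => [])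

/-- `e` is a peer-to-peer execution of `S`. -/
def p2pAsEx (S : CSystem P M St) (e : List (Act P M)) : Prop :=
  ∃ c, P2PExecFrom S (p2pInitConf S) e c

/-- `S` is `k`-synchronizable as a peer-to-peer system. -/
def P2PKSynchronizable (k : ℕ) (S : CSystem P M St) : Prop :=
  ∀ e, p2pAsEx S e → P2PKSyncSeq k e

/-- Feasibility for peer-to-peer systems. -/
def P2PFeasible (S : CSystem P M St) (e' : List (IAct P M)) : Prop :=
  ∃ ec, p2pAsEx S ec ∧ Deviate e' ec

/-- Badness for peer-to-peer systems. -/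
def P2PBadExec (k : ℕ) (S : CSystem P M St) (e' : List (IAct P M)) : Prop :=
  ∃ ec, p2pAsEx S ec ∧ Deviate e' ec ∧ ¬ P2PKSyncSeq k ec

/-- The staged update `B_1, …, B_{m+1}` of the forbidden-senders map along `e`. -/
def stageB (e : List (Act P M)) (B : P → Set P) : ℕ → P → Set P
  | 0 => B
  | (i + 1) => fun q =>
      stageB e B i q ∪ {p | ∃ m, e[i]? = some (Act.send p q m) ∧ ¬ MatchedSend e i}

/-- The peer-to-peer transition relation `(l⃗,B) ⇝^e_k (l⃗',B')`. -/
def P2PKExch (S : CSystem P M St) (k : ℕ) (e : List (Act P M))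
    (c c' : (P → St) × (P → Set P)) : Prop :=
  (∃ ss rs : List (Act P M), e = ss ++ rs ∧ (∀ a ∈ ss, a.isSend) ∧ (∀ a ∈ rs, a.isRecv) ∧
    rs.length ≤ ss.length ∧ ss.length ≤ k) ∧
  (∃ buf, P2PExecFrom S (c.1, fun _ _ => []) e (c'.1, buf)) ∧
  c'.2 = stageB e c.2 e.length ∧
  ∀ i p q m, e[i]? = some (Act.send p q m) → MatchedSend e i → p ∉ stageB e c.2 i q

inductive P2PKChain (S : CSystem P M St) (k : ℕ) :
    ((P → St) × (P → Set P)) → List (List (Act P M)) → ((P → St) × (P → Set P)) → Prop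
  | nil {c} : P2PKChain S k c [] c
  | cons {c e c' es c''} :
      P2PKExch S k e c c' → P2PKChain S k c' es c'' → P2PKChain S k c (e :: es) c''

end P2P

/-- Abstract configurations `(l⃗, B, exp, dest)` for the peer-to-peer instrumented system. -/
structure P2PPiConf (P M St : Type) : Type where
  gs : IProc P → ISt P M St
  B : IProc P → Set (IProc P)
  exp : Option P
  dest : Option P

section P2PPi
variable {P M St : Type} [DecidableEq P] [DecidableEq M]

/-- The peer-to-peer transition relation `(l⃗,B,exp,dest) ⇝^e_k (l⃗',B',exp',dest')`. -/
def P2PPiTrans (S : CSystem P M St) (k : ℕ) (e : List (IAct P M))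
    (c c' : P2PPiConf P M St) : Prop :=
  P2PKExch (instrumented S) k e (c.gs, c.B) (c'.gs, c'.B) ∧
  (∀ v, ¬ SenderIs e v (none : IProc P)) ∧
  (∀ v v', ReceiverIs e v (none : IProc P) → ReceiverIs e v' (none : IProc P) →
    v = v' ∧ c.dest = none) ∧
  ((∃ (d : ℕ) (p q : P) (m : M),
      e[d]? = some (Act.send (some p) none (Sum.inr (q, m))) ∧
      c'.exp = some p ∧ c'.dest = some q ∧
      (c.dest = none → ∀ v, d < v → MatchedSend e v →
        ¬ (SenderIs e v (some p) ∧ ReceiverIs e v (some q)))) ∨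
   ((¬ ∃ (d : ℕ) (p q : P) (m : M),
      e[d]? = some (Act.send (some p) none (Sum.inr (q, m)))) ∧
      c'.exp = c.exp ∧ c'.dest = c.dest)) ∧
  (c.dest ≠ none → c'.dest = c.dest ∧ c'.exp = c.exp) ∧
  (∀ p q : P, c'.exp = some p → c'.dest = some q → c.dest ≠ none →
    ∀ v, MatchedSend e v → ¬ (SenderIs e v (some p) ∧ ReceiverIs e v (some q)))

inductive P2PPiChain (S : CSystem P M St) (k : ℕ) :
    P2PPiConf P M St → List (List (IAct P M)) → P2PPiConf P M St → Prop
  | nil {c} : P2PPiChain S k c [] c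
  | cons {c e c' es c''} :
      P2PPiTrans S k e c c' → P2PPiChain S k c' es c'' → P2PPiChain S k c (e :: es) c''

/-- The initial abstract configuration `(l⃗_0, B_0, ⊥, ⊥)`. -/
def initP2PPi (S : CSystem P M St) : P2PPiConf P M St :=
  ⟨(instrumented S).init, fun _ => ∅, none, none⟩

end P2PPi

/-! ## Statement 13: graph-theoretic characterisation of k-synchrony, peer-to-peer case. -/

theorem Act.isRecv_of_not_isSend {P M : Type} {a : Act P M} (h : ¬ a.isSend) : a.isRecv := by
  cases a <;> simp_all [Act.isSend, Act.isRecv]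

theorem List.sum_map_length_take_succ {α : Type} {L : List (List α)} {b : ℕ} {l : List α}
    (h : L[b]? = some l) :
    ((L.take (b + 1)).map List.length).sum = ((L.take b).map List.length).sum + l.length := by
  rw [List.take_add_one, h]
  simp

theorem List.sum_map_length_take_mono {α : Type} (L : List (List α)) {b c : ℕ} (h : b ≤ c) :
    ((L.take b).map List.length).sum ≤ ((L.take c).map List.length).sum := by
  obtain ⟨d, rfl⟩ := Nat.exists_eq_add_of_le h
  rw [List.take_add]
  simp

theorem List.exists_block_of_lt_length_flatten {α : Type} (L : List (List α)) (i : ℕ)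
    (h : i < L.flatten.length) :
    ∃ b l, L[b]? = some l ∧ ((L.take b).map List.length).sum ≤ i ∧
      i < ((L.take (b + 1)).map List.length).sum ∧
      l[i - ((L.take b).map List.length).sum]? = L.flatten[i]? := by
  induction L generalizing i with
  | nil => simp at h
  | cons l L ih =>
    by_cases hi : i < l.length
    · refine ⟨0, l, by simp, by simp, by simpa using hi, ?_⟩
      simp [List.getElem?_append_left hi]
    · rw [List.flatten_cons, List.length_append] at h
      obtain ⟨b, l', h1, h2, h3, h4⟩ := ih (i - l.length) (by omega)
      refine ⟨b + 1, l', by simpa using h1, ?_, ?_, ?_⟩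
      · simp only [List.take_succ_cons, List.map_cons, List.sum_cons]; omega
      · simp only [List.take_succ_cons, List.map_cons, List.sum_cons] at h3 ⊢; omega
      · rw [List.flatten_cons, List.getElem?_append_right (by omega), ← h4]
        simp only [List.take_succ_cons, List.map_cons, List.sum_cons]
        congr 1; omega

theorem List.block_le_of_le {α : Type} {L : List (List α)} {i j b c : ℕ}
    (hi : ((L.take b).map List.length).sum ≤ i)
    (hj : j < ((L.take (c + 1)).map List.length).sum) (hij : i ≤ j) : b ≤ c := by
  by_contra hbc
  have := L.sum_map_length_take_mono (show c + 1 ≤ b by omega)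
  omega

/-- A finite preorder admits a monotone colouring by natural numbers whose colour classes
consist of equivalent elements. -/
theorem exists_topological_colouring {n : ℕ} (r : Fin n → Fin n → Prop)
    (hrefl : ∀ a, r a a) (htrans : ∀ a b c, r a b → r b c → r a c) :
    ∃ c : Fin n → ℕ, (∀ a b, r a b → c a ≤ c b) ∧ ∀ a b, c a = c b → r a b := by
  classical
  have hne : ∀ v : Fin n, (Finset.univ.filter fun u => r u v ∧ r v u).Nonempty :=
    fun v => ⟨v, by simp [hrefl]⟩
  let N : Fin n → ℕ := fun v => (Finset.univ.filter fun u => r u v).card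
  let rep : Fin n → Fin n := fun v => (Finset.univ.filter fun u => r u v ∧ r v u).min' (hne v)
  have hrep : ∀ v, r (rep v) v ∧ r v (rep v) := fun v => by
    simpa using Finset.min'_mem _ (hne v)
  refine ⟨fun v => n * N v + rep v, fun a b hab => ?_, fun a b hab => ?_⟩
  · by_cases hba : r b a
    · have hN : ∀ u, r u a ↔ r u b :=
        fun u => ⟨fun h => htrans _ _ _ h hab, fun h => htrans _ _ _ h hba⟩
      have hN' : ∀ u, r a u ↔ r b u :=
        fun u => ⟨fun h => htrans _ _ _ hba h, fun h => htrans _ _ _ hab h⟩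
      have h1 : N a = N b := by simp only [N, hN]
      have h2 : rep a = rep b := by simp only [rep, hN, hN']
      simp only [h1, h2]; exact le_rfl
    · have h1 : N a < N b := by
        apply Finset.card_lt_card
        rw [Finset.ssubset_iff_of_subset]
        · exact ⟨b, by simp [hrefl], by simpa using hba⟩
        · intro u hu
          simp only [Finset.mem_filter, Finset.mem_univ, true_and] at hu ⊢
          exact htrans _ _ _ hu hab
      have h2 := (rep a).isLt
      have h3 : n * (N a + 1) ≤ n * N b := Nat.mul_le_mul_left _ h1
      simp only [mul_add, mul_one] at h3
      simp only
      omega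
  · have h : (rep a : ℕ) = rep b := by
      have := congrArg (· % n) hab
      simpa [Nat.mul_add_mod, Nat.mod_eq_of_lt (rep a).isLt, Nat.mod_eq_of_lt (rep b).isLt]
        using this
    have h' : rep a = rep b := Fin.ext h
    exact htrans _ _ _ (hrep a).2 (h' ▸ (hrep b).1)

theorem List.count_take_lt_count_take {α : Type} [DecidableEq α] {l : List α} {x : α} {i j : ℕ}
    (hj : l[j]? = some x) (hij : i < j) :
    (l.take (i + 1)).count x < (l.take (j + 1)).count x := by
  rw [List.take_add_one (i := j), hj, List.count_append]
  have : ((l.take (i + 1)).count x) ≤ (l.take j).count x :=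
    ((List.take_prefix_take_left (by omega)).sublist).count_le x
  simp
  omega

theorem List.eq_of_count_take_eq {α : Type} [DecidableEq α] {l : List α} {x : α} {i j : ℕ}
    (hi : l[i]? = some x) (hj : l[j]? = some x)
    (h : (l.take (i + 1)).count x = (l.take (j + 1)).count x) : i = j := by
  rcases lt_trichotomy i j with hij | hij | hij
  · have := List.count_take_lt_count_take hj hij; omega
  · exact hij
  · have := List.count_take_lt_count_take hi hij; omega

theorem List.count_take_eq_card {α : Type} [DecidableEq α] (l : List α) (x : α) (i : ℕ) :
    (l.take i).count x =
      (Finset.univ.filter fun j : Fin l.length => (j : ℕ) < i ∧ l.get j = x).card := by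
  induction l generalizing i with
  | nil => simp
  | cons a l ih =>
    cases i with
    | zero => simp
    | succ i =>
      rw [List.take_succ_cons, List.count_cons, ih]
      have := Fin.card_filter_univ_succ
        (fun j : Fin (l.length + 1) => (j : ℕ) < i + 1 ∧ (a :: l).get j = x)
      simp at this ⊢
      rw [this]
      split_ifs <;> omega

section MatchingAndIso
variable {P M : Type} [DecidableEq P] [DecidableEq M]

theorem Matches.lt {e : List (Act P M)} {i j : ℕ} (h : Matches e i j) : i < j := h.1

theorem Matches.left_unique {e : List (Act P M)} {i i' j : ℕ} (h : Matches e i j)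
    (h' : Matches e i' j) : i = i' := by
  obtain ⟨_, _, p, q, m, h1, h2, h3⟩ := h
  obtain ⟨_, _, p', q', m', h1', h2', h3'⟩ := h'
  rw [h2] at h2'
  obtain ⟨rfl, rfl, rfl⟩ : p = p' ∧ q = q' ∧ m = m' := by simpa using h2'
  exact List.eq_of_count_take_eq h1 h1' (h3.trans h3'.symm)

theorem Matches.right_unique {e : List (Act P M)} {i j j' : ℕ} (h : Matches e i j)
    (h' : Matches e i j') : j = j' := by
  obtain ⟨_, _, p, q, m, h1, h2, h3⟩ := h
  obtain ⟨_, _, p', q', m', h1', h2', h3'⟩ := h'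
  rw [h1] at h1'
  obtain ⟨rfl, rfl, rfl⟩ : p = p' ∧ q = q' ∧ m = m' := by simpa using h1'
  exact List.eq_of_count_take_eq h2 h2' (h3.symm.trans h3')

theorem count_take_eq_of_po_preserving {e e' : List (Act P M)} (f : Fin e'.length ≃ Fin e.length)
    (hlab : ∀ i, e.get (f i) = e'.get i)
    (hpo : ∀ i j, i < j → (e'.get i).proc = (e'.get j).proc → f i < f j) (i : Fin e'.length) :
    (e'.take (i + 1)).count (e'.get i) = (e.take (f i + 1)).count (e'.get i) := by
  rw [List.count_take_eq_card, List.count_take_eq_card]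
  refine Finset.card_equiv f fun j => ?_
  simp only [Finset.mem_filter, Finset.mem_univ, true_and, hlab, Nat.lt_succ_iff, Fin.val_fin_le]
  refine and_congr_left fun hj => ?_
  have hp : (e'.get j).proc = (e'.get i).proc := by rw [hj]
  constructor
  · intro h
    rcases h.eq_or_lt with rfl | h
    · exact le_rfl
    · exact (hpo _ _ h hp).le
  · intro h
    by_contra hlt
    exact absurd (hpo _ _ (not_le.mp hlt) hp.symm) (not_lt.mpr h)

/-- Reordering a well-formed sequence while keeping the order of the actions of each process
and keeping each receive after its send does not change the MSC. -/
theorem linearisation_of_order_preserving {e e' : List (Act P M)} (hwf : WFSeq e)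
    (f : Fin e'.length ≃ Fin e.length) (hlab : ∀ i, e.get (f i) = e'.get i)
    (hpo : ∀ i j, i < j → (e'.get i).proc = (e'.get j).proc → f i < f j)
    (hsrc : ∀ i j, Matches e (f i) (f j) → i < j) :
    (∀ i j : Fin e'.length, Matches e' i j ↔ Matches e (f i) (f j)) ∧
      Linearisation e' (mscOf e) := by
  have hcount := count_take_eq_of_po_preserving f hlab hpo
  have hget : ∀ (i : Fin e'.length), e[(f i : ℕ)]? = e'[(i : ℕ)]? := fun i => by
    have := hlab i
    simp only [List.get_eq_getElem] at this
    simp [this]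
  have hget' : ∀ (i : Fin e'.length), e'[(i : ℕ)]? = some (e'.get i) := fun i => by simp
  have hmatch : ∀ i j : Fin e'.length, Matches e' i j ↔ Matches e (f i) (f j) := by
    intro i j
    constructor
    · rintro ⟨h1, h2, p, q, m, h3, h4, h5⟩
      have hi := hcount i
      have hj := hcount j
      rw [Option.some_inj.mp ((hget' i).symm.trans h3)] at hi
      rw [Option.some_inj.mp ((hget' j).symm.trans h4)] at hj
      obtain ⟨s, hs⟩ := hwf (f j) p q m ((hget j).trans h4)
      obtain ⟨_, _, p', q', m', h3', h4', h5'⟩ := id hs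
      have h4'' := h4'.symm.trans ((hget j).trans h4)
      obtain ⟨rfl, rfl, rfl⟩ : p' = p ∧ q' = q ∧ m' = m := by simpa using h4''
      have : s = f i := List.eq_of_count_take_eq h3' ((hget i).trans h3) (by omega)
      rwa [← this]
    · intro h
      have hlt := hsrc i j h
      obtain ⟨_, _, p, q, m, h3, h4, h5⟩ := h
      rw [hget] at h3 h4
      have hi := hcount i
      have hj := hcount j
      rw [Option.some_inj.mp ((hget' i).symm.trans h3)] at hi
      rw [Option.some_inj.mp ((hget' j).symm.trans h4)] at hj
      exact ⟨hlt, j.isLt, p, q, m, h3, h4, by omega⟩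
  refine ⟨hmatch, ?_, f, hlab, ?_, hmatch⟩
  · intro j p q m hj
    have hjl : j < e'.length := (List.getElem?_eq_some_iff.mp hj).1
    obtain ⟨s, hs⟩ := hwf (f ⟨j, hjl⟩) p q m ((hget ⟨j, hjl⟩).trans hj)
    refine ⟨f.symm ⟨s, hs.lt.trans (f ⟨j, hjl⟩).isLt⟩, ?_⟩
    exact (hmatch _ ⟨j, hjl⟩).mpr (by simpa using hs)
  · suffices h : ∀ i j : Fin e'.length, (i < j ∧ (e'.get i).proc = (e'.get j).proc) ↔
      (f i < f j ∧ (e.get (f i)).proc = (e.get (f j)).proc) from h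
    intro i j
    rw [hlab, hlab]
    refine and_congr_left fun hp => ⟨fun h => hpo _ _ h hp, fun h => ?_⟩
    by_contra hlt
    rcases (not_lt.mp hlt).eq_or_lt with heq | hlt
    · exact absurd h (by rw [heq]; exact lt_irrefl _)
    · exact absurd (hpo _ _ hlt hp.symm) (not_lt.mpr h.le)

end MatchingAndIso

section BlocksToGraph
variable {P M : Type} [DecidableEq P] [DecidableEq M]

theorem XAt.lt_length {e : List (Act P M)} {v i : ℕ} {X : SR} (h : XAt e v X i) :
    v < e.length ∧ i < e.length := by
  cases X with
  | S =>
    obtain ⟨rfl, p, q, m, h⟩ := h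
    have := (List.getElem?_eq_some_iff.mp h).1
    exact ⟨this, this⟩
  | R =>
    obtain ⟨h1, h2, _⟩ := h
    exact ⟨h1.trans h2, h2⟩

theorem scc_le_and_no_RS_cycle_of_blocks {k : ℕ} {e : List (Act P M)} {es : List (List (Act P M))}
    (hlin : Linearisation es.flatten (mscOf e)) (hblock : ∀ b ∈ es, IsBlock k b)
    (hsame : ∀ i j, Matches es.flatten i j → SameBlock es i j) :
    (∀ U : Finset ℕ, IsSCC e U → U.card ≤ k) ∧
      ¬ ∃ v v', CGEdge e SR.R SR.S v v' ∧ Reach e v' v := by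
  classical
  obtain ⟨-, f, hlab, hpo, hsrc⟩ := hlin
  change Fin es.flatten.length ≃ Fin e.length at f
  change ∀ i, e.get (f i) = es.flatten.get i at hlab
  have hpo' : ∀ i j : Fin es.flatten.length, f i < f j →
      (e.get (f i)).proc = (e.get (f j)).proc → i < j :=
    fun i j h h' => ((hpo i j).mpr ⟨h, h'⟩).1
  change ∀ i j : Fin es.flatten.length, Matches es.flatten i j ↔ Matches e (f i) (f j) at hsrc
  choose blk lst hlst hlo hhi hat using
    fun i : Fin es.flatten.length => es.exists_block_of_lt_length_flatten i i.isLt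
  have hmono : ∀ i j, i ≤ j → blk i ≤ blk j := fun i j h => List.block_le_of_le (hlo i) (hhi j) h
  have hblkM : ∀ i j : Fin es.flatten.length, Matches e (f i) (f j) → blk i = blk j := by
    intro i j h
    obtain ⟨b, -, h1, h2, h3, h4⟩ := hsame i j ((hsrc i j).mpr h)
    have e1 : blk i = b := le_antisymm (List.block_le_of_le (hlo i) h2 le_rfl)
      (List.block_le_of_le h1 (hhi i) le_rfl)
    have e2 : blk j = b := le_antisymm (List.block_le_of_le (hlo j) h4 le_rfl)
      (List.block_le_of_le h3 (hhi j) le_rfl)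
    rw [e1, e2]
  let g : ∀ v, v < e.length → Fin es.flatten.length := fun v h => f.symm ⟨v, h⟩
  have hfg : ∀ v h, f (g v h) = ⟨v, h⟩ := fun v h => by simp [g]
  let B : ℕ → ℕ := fun v => if h : v < e.length then blk (g v h) else 0
  have hXB : ∀ v X i (h : XAt e v X i), blk (g i h.lt_length.2) = B v := by
    intro v X i h
    have hl := h.lt_length
    simp only [B, dif_pos hl.1]
    cases X with
    | S => obtain ⟨rfl, -⟩ := h; rfl
    | R =>
      have h : Matches e v i := h
      exact (hblkM _ _ (by simpa only [hfg] using h)).symm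
  have hlt : ∀ X Y v v' i j (hi : XAt e v X i) (hj : XAt e v' Y j), i < j →
      (∃ a a' : Act P M, e[i]? = some a ∧ e[j]? = some a' ∧ a.proc = a'.proc) →
      g i hi.lt_length.2 < g j hj.lt_length.2 := by
    rintro X Y v v' i j hi hj hij ⟨a, a', ha, ha', hp⟩
    refine hpo' _ _ (by rw [hfg, hfg]; exact hij) ?_
    rw [hfg, hfg]
    have h1 := (List.getElem?_eq_some_iff.mp ha).2
    have h2 := (List.getElem?_eq_some_iff.mp ha').2
    simp only [List.get_eq_getElem, h1, h2, hp]
  have hstep : ∀ v v', CGStep e v v' → B v ≤ B v' := by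
    rintro v v' ⟨X, Y, i, j, hi, hj, hij, hp⟩
    rw [← hXB v X i hi, ← hXB v' Y j hj]
    exact hmono _ _ (hlt X Y v v' i j hi hj hij hp).le
  have hreach : ∀ v v', Reach e v v' → B v ≤ B v' := by
    intro v v' h
    induction h with
    | refl => exact le_rfl
    | tail _ h ih => exact ih.trans (hstep _ _ h)
  have hbase : ∀ i : Fin es.flatten.length, ∀ a, e.get (f i) = a → ∀ ss rs, lst i = ss ++ rs →
      (∀ a ∈ ss, a.isSend) → (∀ a ∈ rs, a.isRecv) →
      (a.isSend → i - ((es.take (blk i)).map List.length).sum < ss.length) ∧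
      (a.isRecv → ss.length ≤ i - ((es.take (blk i)).map List.length).sum) := by
    intro i a ha ss rs hl hss hrs
    have h := hat i
    have h' : es.flatten[(i : ℕ)]? = some a := by
      rw [← ha, hlab]; simp only [List.get_eq_getElem]; exact List.getElem?_eq_getElem i.isLt
    rw [h', hl] at h
    constructor
    · intro hs
      by_contra hge
      rw [List.getElem?_append_right (by omega)] at h
      have := hrs a (List.mem_of_getElem? h)
      cases a <;> simp_all [Act.isSend, Act.isRecv]
    · intro hs
      by_contra hge
      rw [List.getElem?_append_left (by omega)] at h
      have := hss a (List.mem_of_getElem? h)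
      cases a <;> simp_all [Act.isSend, Act.isRecv]
  have hvl : ∀ v, IsVertex e v → v < e.length := by
    rintro v ⟨p, q, m, h⟩
    exact (List.getElem?_eq_some_iff.mp h).1
  constructor
  · intro U hU
    rcases U.eq_empty_or_nonempty with rfl | ⟨v₀, hv₀⟩
    · simp
    have h₀ := hvl v₀ (hU.1 v₀ hv₀)
    obtain ⟨ss, rs, hl, hss, hrs, hk, -⟩ := hblock _ (List.mem_of_getElem? (hlst (g v₀ h₀)))
    have hB : ∀ v (hv : v ∈ U), blk (g v (hvl v (hU.1 v hv))) = blk (g v₀ h₀) := by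
      intro v hv
      have h := le_antisymm (hreach _ _ (hU.2 v hv v₀ hv₀).1) (hreach _ _ (hU.2 v hv v₀ hv₀).2)
      simpa only [B, dif_pos h₀, dif_pos (hvl v (hU.1 v hv))] using h
    rw [← Finset.card_attach]
    refine le_trans ?_ hk
    rw [← Finset.card_range ss.length]
    refine Finset.card_le_card_of_injOn (fun v => (g v.1 (hvl v.1 (hU.1 v.1 v.2)) : ℕ) -
      ((es.take (blk (g v₀ h₀))).map List.length).sum) ?_ ?_
    · rintro ⟨v, hv⟩ -
      have hb := hB v hv
      have hll : lst (g v (hvl v (hU.1 v hv))) = lst (g v₀ h₀) := by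
        have := hlst (g v (hvl v (hU.1 v hv)))
        rw [hb, hlst] at this
        exact (Option.some_inj.mp this).symm
      obtain ⟨p, q, m, hs⟩ := hU.1 v hv
      have := (hbase (g v (hvl v (hU.1 v hv))) (Act.send p q m)
        (by rw [hfg]; exact (List.getElem?_eq_some_iff.mp hs).2) ss rs (hll.trans hl) hss hrs).1
        trivial
      rw [hb] at this
      simpa using this
    · rintro ⟨v, hv⟩ - ⟨w, hw⟩ - hvw
      have h1 := hlo (g v (hvl v (hU.1 v hv)))
      have h2 := hlo (g w (hvl w (hU.1 w hw)))
      rw [hB v hv] at h1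
      rw [hB w hw] at h2
      have h3 : g v (hvl v (hU.1 v hv)) = g w (hvl w (hU.1 w hw)) := by
        apply Fin.ext
        simp only at hvw
        omega
      have h4 := f.symm.injective h3
      simpa using h4
  · rintro ⟨v, v', ⟨i, j, hi, hj, hij, hp⟩, hr⟩
    have hlt' := hlt _ _ v v' i j hi hj hij hp
    have hb : blk (g i hi.lt_length.2) = blk (g j hj.lt_length.2) := by
      refine le_antisymm (hmono _ _ hlt'.le) ?_
      rw [hXB _ _ _ hi, hXB _ _ _ hj]
      exact hreach _ _ hr
    have hll : lst (g i hi.lt_length.2) = lst (g j hj.lt_length.2) := by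
      have := hlst (g i hi.lt_length.2)
      rw [hb, hlst] at this
      exact (Option.some_inj.mp this).symm
    obtain ⟨ss, rs, hl, hss, hrs, -⟩ :=
      hblock _ (List.mem_of_getElem? (hlst (g j hj.lt_length.2)))
    obtain ⟨-, -, p, q, m, -, hrec, -⟩ := id hi
    obtain ⟨rfl, p', q', m', hsend⟩ := id hj
    have h1 := (hbase _ (Act.recv p q m) (by
      rw [hfg]; exact (List.getElem?_eq_some_iff.mp hrec).2) ss rs (hll.trans hl) hss hrs).2 trivial
    have h2 := (hbase _ (Act.send p' q' m') (by
      rw [hfg]; exact (List.getElem?_eq_some_iff.mp hsend).2) ss rs hl hss hrs).1 trivial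
    rw [hb] at h1
    have : (g i hi.lt_length.2 : ℕ) < g _ hj.lt_length.2 := hlt'
    omega

end BlocksToGraph

section GraphToBlocks
variable {P M : Type} [DecidableEq P] [DecidableEq M]

theorem exists_blocks_of_scc_le_and_no_RS_cycle {k : ℕ} {e : List (Act P M)} (hwf : WFSeq e)
    (hscc : ∀ U : Finset ℕ, IsSCC e U → U.card ≤ k)
    (hRS : ¬ ∃ v v', CGEdge e SR.R SR.S v v' ∧ Reach e v' v) :
    ∃ es : List (List (Act P M)), Linearisation es.flatten (mscOf e) ∧
      (∀ b ∈ es, IsBlock k b) ∧ ∀ i j, Matches es.flatten i j → SameBlock es i j := by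
  classical
  obtain ⟨c, hc, hc'⟩ := exists_topological_colouring
    (fun a b : Fin e.length => Reach e a b) (fun _ => Relation.ReflTransGen.refl)
    (fun _ _ _ => Relation.ReflTransGen.trans)
  have hvtx : ∀ i : Fin e.length, ∃ v : Fin e.length,
      ((e.get i).isSend → v = i ∧ IsVertex e i) ∧ (¬ (e.get i).isSend → Matches e v i) := by
    intro i
    have hi : e[(i : ℕ)]? = some (e.get i) := by simp
    generalize e.get i = a at hi
    cases a with
    | send p q m => exact ⟨i, fun _ => ⟨rfl, p, q, m, hi⟩, fun h => absurd trivial h⟩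
    | recv p q m =>
      obtain ⟨s, hs⟩ := hwf i p q m hi
      exact ⟨⟨s, hs.lt.trans i.isLt⟩, fun h => h.elim, fun _ => hs⟩
  choose vtx hvS hvR using hvtx
  have hstep : ∀ i j : Fin e.length, i < j → (e.get i).proc = (e.get j).proc →
      Reach e (vtx i) (vtx j) ∧ (¬ (e.get i).isSend → (e.get j).isSend →
        CGEdge e SR.R SR.S (vtx i) (vtx j)) := by
    intro i j hij hp
    have hpp : ∃ a a' : Act P M, e[(i : ℕ)]? = some a ∧ e[(j : ℕ)]? = some a' ∧
        a.proc = a'.proc := ⟨e.get i, e.get j, by simp, by simp, hp⟩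
    have hX : ∀ i : Fin e.length, ∃ X, XAt e (vtx i) X i := by
      intro i
      by_cases h : (e.get i).isSend
      · obtain ⟨h1, h2⟩ := hvS i h
        exact ⟨SR.S, by rw [h1], by rwa [h1]⟩
      · exact ⟨SR.R, hvR i h⟩
    obtain ⟨X, hX'⟩ := hX i
    obtain ⟨Y, hY'⟩ := hX j
    refine ⟨Relation.ReflTransGen.single ⟨X, Y, i, j, hX', hY', hij, hpp⟩, fun h1 h2 => ?_⟩
    obtain ⟨h3, h4⟩ := hvS j h2
    exact ⟨i, j, hvR i h1, ⟨by rw [h3], by rwa [h3]⟩, hij, hpp⟩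
  have hvM : ∀ i j : Fin e.length, Matches e i j →
      (e.get i).isSend ∧ ¬ (e.get j).isSend ∧ vtx i = vtx j := by
    intro i j h
    obtain ⟨_, _, p, q, m, h1, h2, _⟩ := id h
    have h1' : e.get i = Act.send p q m := (List.getElem?_eq_some_iff.mp h1).2
    have h2' : e.get j = Act.recv p q m := (List.getElem?_eq_some_iff.mp h2).2
    have hi : (e.get i).isSend := by rw [h1']; trivial
    have hj : ¬ (e.get j).isSend := by rw [h2']; exact id
    exact ⟨hi, hj, (hvS i hi).1.trans (Fin.ext (h.left_unique (hvR j hj)))⟩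
  let sends : ℕ → List (Fin e.length) := fun b =>
    (List.finRange e.length).filter fun i => (e.get i).isSend ∧ c (vtx i) = b
  let recvs : ℕ → List (Fin e.length) := fun b =>
    (List.finRange e.length).filter fun i => ¬ (e.get i).isSend ∧ c (vtx i) = b
  have hms : ∀ b i, i ∈ sends b ↔ (e.get i).isSend ∧ c (vtx i) = b := by simp [sends]
  have hmr : ∀ b i, i ∈ recvs b ↔ ¬ (e.get i).isSend ∧ c (vtx i) = b := by simp [recvs]
  obtain ⟨K, hK⟩ : ∃ K, ∀ i, c i < K :=
    ⟨Finset.univ.sup c + 1, fun i => Nat.lt_succ_of_le (Finset.le_sup (Finset.mem_univ i))⟩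
  let L : List (List (Fin e.length)) := (List.range K).map fun b => sends b ++ recvs b
  have hLb : ∀ b l, L[b]? = some l → l = sends b ++ recvs b := by
    intro b l h
    obtain ⟨hb, h⟩ := List.getElem?_eq_some_iff.mp h
    simpa [L] using h.symm
  have hLc : ∀ b l i, L[b]? = some l → i ∈ l → c (vtx i) = b := by
    intro b l i h hi
    rw [hLb b l h, List.mem_append, hms, hmr] at hi
    rcases hi with hi | hi <;> exact hi.2
  have hmem : ∀ i, i ∈ L.flatten := by
    intro i
    refine List.mem_flatten.mpr ⟨_, List.mem_map.mpr ⟨c (vtx i), by simpa using hK _, rfl⟩, ?_⟩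
    rw [List.mem_append, hms, hmr]
    tauto
  let T : Fin e.length → Fin e.length → Prop := fun j i =>
    (j < i ∧ (e.get j).proc = (e.get i).proc) ∨ Matches e j i
  have hTlt : ∀ i j, T j i → j < i := by
    rintro i j (h | h)
    · exact h.1
    · exact h.lt
  have hTc : ∀ i j, T j i → c (vtx j) ≤ c (vtx i) := by
    rintro i j (h | h)
    · exact hc _ _ (hstep _ _ h.1 h.2).1
    · rw [(hvM _ _ h).2.2]
  have hpw : L.flatten.Pairwise fun a b => a ≠ b ∧ ¬ T b a := by
    have hlt : (List.finRange e.length).Pairwise fun a b => a ≠ b ∧ ¬ T b a :=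
      (List.pairwise_lt_finRange e.length).imp fun h =>
        ⟨ne_of_lt h, fun hT => absurd (hTlt _ _ hT) (not_lt.mpr h.le)⟩
    rw [List.pairwise_flatten]
    constructor
    · intro l hl
      obtain ⟨b, -, rfl⟩ := List.mem_map.mp hl
      refine List.pairwise_append.mpr ⟨hlt.filter _, hlt.filter _, fun i hi j hj => ?_⟩
      rw [hms] at hi
      rw [hmr] at hj
      refine ⟨fun h => hj.1 (h ▸ hi.1), ?_⟩
      rintro (h | h)
      · exact hRS ⟨vtx j, vtx i, (hstep j i h.1 h.2).2 hj.1 hi.1, hc' _ _ (hi.2.trans hj.2.symm)⟩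
      · exact hj.1 (hvM _ _ h).1
    · refine List.pairwise_map.mpr (List.pairwise_lt_range.imp fun {b b'} hbb' i hi j hj => ?_)
      rw [List.mem_append, hms, hmr] at hi hj
      have h1 : c (vtx i) = b := by tauto
      have h2 : c (vtx j) = b' := by tauto
      refine ⟨fun h => ?_, fun h => ?_⟩
      · rw [h] at h1; omega
      · have := hTc _ _ h; omega
  have hnd : L.flatten.Nodup := hpw.imp fun h => h.1
  let es : List (List (Act P M)) := L.map (List.map e.get)
  have hfl : es.flatten = L.flatten.map e.get := by simp only [es, List.map_flatten]
  have hlen : es.flatten.length = L.flatten.length := by rw [hfl, List.length_map]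
  have hstart : ∀ b, blockStart es b = ((L.take b).map List.length).sum := by
    intro b
    simp only [blockStart, es, ← List.map_take, List.map_map]
    congr 1
    exact List.map_congr_left fun l _ => by simp
  let f : Fin es.flatten.length ≃ Fin e.length :=
    (finCongr hlen).trans (hnd.getEquivOfForallMemList _ hmem)
  have hf : ∀ i, f i = L.flatten[(i : ℕ)]'(hlen ▸ i.isLt) := fun i => rfl
  have hlab : ∀ i, e.get (f i) = es.flatten.get i := by
    intro i
    rw [hf]
    simp only [List.get_eq_getElem, hfl, List.getElem_map]
  have hord : ∀ i j, T (f i) (f j) → i < j := by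
    intro i j h
    by_contra hij
    rcases (not_lt.mp hij).eq_or_lt with rfl | hij
    · exact lt_irrefl _ (hTlt _ _ h)
    · have := List.pairwise_iff_getElem.mp hpw j i (hlen ▸ j.isLt) (hlen ▸ i.isLt) hij
      exact this.2 h
  obtain ⟨hmatch, hlin⟩ := linearisation_of_order_preserving hwf f hlab
    (fun i j hij hp => by
      rw [← hlab, ← hlab] at hp
      by_contra hlt
      rcases (not_lt.mp hlt).eq_or_lt with heq | hlt
      · exact absurd (f.injective heq) hij.ne'
      · exact absurd (hord j i (Or.inl ⟨hlt, hp.symm⟩)) (not_lt.mpr hij.le))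
    (fun i j h => hord i j (Or.inr h))
  have hsendk : ∀ b, (sends b).toFinset.card ≤ k := by
    intro b
    rw [← Finset.card_map Fin.valEmbedding]
    apply hscc
    have key : ∀ v ∈ (sends b).toFinset.map Fin.valEmbedding,
        ∃ i : Fin e.length, (i : ℕ) = v ∧ IsVertex e i ∧ c i = b := by
      intro v hv
      obtain ⟨i, hi, rfl⟩ := Finset.mem_map.mp hv
      rw [List.mem_toFinset, hms] at hi
      obtain ⟨h1, h2⟩ := hvS i hi.1
      exact ⟨i, rfl, h2, by rw [← hi.2, h1]⟩
    constructor
    · intro v hv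
      obtain ⟨i, rfl, h, -⟩ := key v hv
      exact h
    · intro v hv v' hv'
      obtain ⟨i, rfl, -, h⟩ := key v hv
      obtain ⟨j, rfl, -, h'⟩ := key v' hv'
      exact ⟨hc' _ _ (h.trans h'.symm), hc' _ _ (h'.trans h.symm)⟩
  have hrecvk : ∀ b, (recvs b).toFinset.card ≤ k := by
    intro b
    refine le_trans (Finset.card_le_card_of_injOn vtx ?_ ?_) (hsendk b)
    · intro i hi
      simp only [Finset.mem_coe, List.mem_toFinset, hms, hmr] at hi ⊢
      have h := hvM _ _ (hvR i hi.1)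
      exact ⟨h.1, by rw [h.2.2, hi.2]⟩
    · intro i hi j hj hij
      simp only [Finset.mem_coe, List.mem_toFinset, hmr] at hi hj
      have h := hvR i hi.1
      rw [hij] at h
      exact Fin.ext (h.right_unique (hvR j hj.1))
  refine ⟨es, hlin, ?_, ?_⟩
  · intro l hl
    obtain ⟨l', hl', rfl⟩ := List.mem_map.mp hl
    obtain ⟨b, -, rfl⟩ := List.mem_map.mp hl'
    refine ⟨(sends b).map e.get, (recvs b).map e.get, List.map_append, ?_, ?_, ?_, ?_⟩
    · intro a ha
      obtain ⟨i, hi, rfl⟩ := List.mem_map.mp ha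
      exact ((hms b i).mp hi).1
    · intro a ha
      obtain ⟨i, hi, rfl⟩ := List.mem_map.mp ha
      exact Act.isRecv_of_not_isSend ((hmr b i).mp hi).1
    · rw [List.length_map, ← List.toFinset_card_of_nodup ((List.nodup_finRange _).filter _)]
      exact hsendk b
    · rw [List.length_map, ← List.toFinset_card_of_nodup ((List.nodup_finRange _).filter _)]
      exact hrecvk b
  · intro i j hij
    have hj : j < es.flatten.length := hij.2.1
    have hi : i < es.flatten.length := hij.lt.trans hj
    have hm := (hvM _ _ ((hmatch ⟨i, hi⟩ ⟨j, hj⟩).mp hij)).2.2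
    have hcol : ∀ i (hi : i < es.flatten.length), ∃ b, b < L.length ∧ c (vtx (f ⟨i, hi⟩)) = b ∧
        ((L.take b).map List.length).sum ≤ i ∧ i < ((L.take (b + 1)).map List.length).sum := by
      intro i hi
      obtain ⟨b, l, h1, h2, h3, h4⟩ := L.exists_block_of_lt_length_flatten i (hlen ▸ hi)
      refine ⟨b, (List.getElem?_eq_some_iff.mp h1).1, hLc b l _ h1 ?_, h2, h3⟩
      rw [hf]
      rw [List.getElem?_eq_getElem (show i < L.flatten.length from hlen ▸ hi)] at h4
      exact List.mem_of_getElem? h4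
    obtain ⟨b, hb, hcb, h1, h2⟩ := hcol i hi
    obtain ⟨b', -, hcb', h3, h4⟩ := hcol j hj
    obtain rfl : b = b' := by rw [← hcb, ← hcb', hm]
    refine ⟨b, by simpa [es] using hb, ?_⟩
    simp only [hstart]
    exact ⟨h1, h2, h3, h4⟩

end GraphToBlocks

theorem p2p_ksynchronous_iff_scc_and_no_RS_cycle
    {P M : Type} [Fintype P] [DecidableEq P] [Fintype M] [DecidableEq M]
    (k : ℕ) (hk : 1 ≤ k) (e : List (Act P M)) (hwf : WFSeq e)
    (hcd : P2PCausalDelivery (mscOf e)) :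
    P2PKSyncMSC k (mscOf e) ↔
      ((∀ U : Finset ℕ, IsSCC e U → U.card ≤ k) ∧
        ¬ ∃ v v', CGEdge e SR.R SR.S v v' ∧ Reach e v' v) := by
  constructor
  · rintro ⟨-, es, hlin, hblock, hsame⟩
    exact scc_le_and_no_RS_cycle_of_blocks hlin hblock hsame
  · rintro ⟨hscc, hRS⟩
    exact ⟨hcd, exists_blocks_of_scc_le_and_no_RS_cycle hwf hscc hRS⟩
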